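/- arXiv:1609.03192 — 10 statements merged into one kernel-verified Lean document; each statement's English description precedes it below -/
import Mathlib

section
/- Let x₁ = x₂. If the (1,2) entry of S₁ vanishes, i.e. (y₁+y₂)/(y₁y₂) − x₂(z₁+z₂)/r = 0, then y₂z₁ = y₁z₂ or y₁z₁ = y₂z₂ (equivalently z₁ = y₁z₂/y₂ or z₁ = y₂z₂/y₁). -/
/-- If `x₁ = x₂` and the (1,2) entry of `S₁`, namely
`(y₁+y₂)/(y₁y₂) − x₂(z₁+z₂)/r`, vanishes, then `y₂z₁ = y₁z₂` or `y₁z₁ = y₂z₂`. -/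
theorem s1_entry_zero_implies
    (x₁ x₂ y₁ y₂ z₁ z₂ r : ℂ)
    (hx₁ : x₁ ≠ 0) (hx₂ : x₂ ≠ 0) (hy₁ : y₁ ≠ 0) (hy₂ : y₂ ≠ 0)
    (hz₁ : z₁ ≠ 0) (hz₂ : z₂ ≠ 0)
    (hr : r ^ 2 = x₁ * x₂ * y₁ * y₂ * z₁ * z₂)
    (hx : x₁ = x₂)
    (h : (y₁ + y₂) / (y₁ * y₂) - x₂ * (z₁ + z₂) / r = 0) :
    y₂ * z₁ = y₁ * z₂ ∨ y₁ * z₁ = y₂ * z₂ := by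
  subst hx
  have hr0 : r ≠ 0 := by
    rintro rfl
    have : x₁ * x₁ * y₁ * y₂ * z₁ * z₂ ≠ 0 := by simp [*]
    exact this (by rw [← hr]; ring)
  have hlin : (y₁ + y₂) * r = x₁ * (z₁ + z₂) * (y₁ * y₂) :=
    (div_eq_div_iff (mul_ne_zero hy₁ hy₂) hr0).mp (sub_eq_zero.mp h)
  have hprod : x₁ ^ 2 * (y₁ * y₂) * ((y₂ * z₁ - y₁ * z₂) * (y₁ * z₁ - y₂ * z₂)) = 0 := by
    linear_combination
      -((y₁ + y₂) * r + x₁ * (z₁ + z₂) * (y₁ * y₂)) * hlin + (y₁ + y₂) ^ 2 * hr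
  have hne : x₁ ^ 2 * (y₁ * y₂) ≠ 0 := mul_ne_zero (pow_ne_zero 2 hx₁) (mul_ne_zero hy₁ hy₂)
  exact (mul_eq_zero.mp ((mul_eq_zero.mp hprod).resolve_left hne)).imp
    sub_eq_zero.mp sub_eq_zero.mp
end

section
/- Let x₁ = x₂. If y₂z₁ ≠ y₁z₂ and y₁z₁ ≠ y₂z₂, then the representation (S₁, S₂, S₃) is irreducible: every ℂ-linear subspace of ℂ² mapped into itself by each of S₁, S₂, S₃ is {0} or ℂ². -/
open Matrix

/-- For `x₁ = x₂ = x`, the off-diagonal entry of `S₁` is nonzero unless `y₂z₁ = y₁z₂` or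
`y₁z₁ = y₂z₂`. -/
theorem upper_entry_ne_zero {x y₁ y₂ z₁ z₂ r : ℂ}
    (hx : x ≠ 0) (hy₁ : y₁ ≠ 0) (hy₂ : y₂ ≠ 0) (hr₀ : r ≠ 0)
    (hr : r ^ 2 = x * x * y₁ * y₂ * z₁ * z₂)
    (h₁ : y₂ * z₁ ≠ y₁ * z₂) (h₂ : y₁ * z₁ ≠ y₂ * z₂) :
    (y₁ + y₂) / (y₁ * y₂) - x * (z₁ + z₂) / r ≠ 0 := by
  intro hb
  have hlin : (y₁ + y₂) * r = x * (z₁ + z₂) * (y₁ * y₂) :=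
    (div_eq_div_iff (mul_ne_zero hy₁ hy₂) hr₀).mp (sub_eq_zero.mp hb)
  have hprod : (x * x * (y₁ * y₂)) * ((y₁ * z₁ - y₂ * z₂) * (y₂ * z₁ - y₁ * z₂)) = 0 := by
    linear_combination
      (y₁ + y₂) ^ 2 * hr - ((y₁ + y₂) * r + x * (z₁ + z₂) * (y₁ * y₂)) * hlin
  exact mul_ne_zero (mul_ne_zero (mul_ne_zero hx hx) (mul_ne_zero hy₁ hy₂))
    (mul_ne_zero (sub_ne_zero.mpr h₂) (sub_ne_zero.mpr h₁)) hprod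

/-- A nonzero subspace of `K²` invariant under a nontrivial Jordan block contains the first
basis vector. -/
theorem first_basis_mem_of_jordan_invariant {K : Type*} [Field K] {a b : K} (hb : b ≠ 0)
    {S : Submodule K (Fin 2 → K)} (hS : S ≠ ⊥)
    (h : ∀ v ∈ S, (!![a, b; 0, a]).mulVec v ∈ S) : ![1, 0] ∈ S := by
  obtain ⟨v, hv, hv₀⟩ := S.ne_bot_iff.mp hS
  by_cases hv₁ : v 1 = 0
  · have hv₀' : v 0 ≠ 0 := fun h0 => hv₀ (by ext i; fin_cases i <;> simp [h0, hv₁])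
    convert S.smul_mem (v 0)⁻¹ hv using 1
    ext i; fin_cases i <;> simp [hv₀', hv₁]
  · convert S.smul_mem (b * v 1)⁻¹ (S.sub_mem (h v hv) (S.smul_mem a hv)) using 1
    ext i
    fin_cases i <;> simp [vecHead, vecTail]
    field_simp

/-- If `x₁ = x₂`, `y₂z₁ ≠ y₁z₂` and `y₁z₁ ≠ y₂z₂`, then the representation
`(S₁, S₂, S₃)` is irreducible: every subspace of `ℂ²` invariant under all
three matrices is `⊥` or `⊤`. -/
theorem irreducible_of_x1_eq_x2
    (x₁ x₂ y₁ y₂ z₁ z₂ r : ℂ)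
    (hx₁ : x₁ ≠ 0) (hx₂ : x₂ ≠ 0) (hy₁ : y₁ ≠ 0) (hy₂ : y₂ ≠ 0)
    (hz₁ : z₁ ≠ 0) (hz₂ : z₂ ≠ 0)
    (hr : r ^ 2 = x₁ * x₂ * y₁ * y₂ * z₁ * z₂)
    (hx : x₁ = x₂)
    (h₁ : y₂ * z₁ ≠ y₁ * z₂) (h₂ : y₁ * z₁ ≠ y₂ * z₂) :
    ∀ S : Submodule ℂ (Fin 2 → ℂ),
      (∀ v ∈ S, (!![x₁, (y₁ + y₂) / (y₁ * y₂) - x₂ * (z₁ + z₂) / r; 0, x₂]).mulVec v ∈ S) →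
      (∀ v ∈ S, (!![y₁ + y₂, 1 / x₁; -(x₁ * y₁ * y₂), 0]).mulVec v ∈ S) →
      (∀ v ∈ S, (!![0, -r / (x₁ * x₂ * y₁ * y₂); r, z₁ + z₂]).mulVec v ∈ S) →
      S = ⊥ ∨ S = ⊤ := by
  subst hx
  intro S hS₁ _ hS₃
  have hr₀ : r ≠ 0 := by
    rw [← pow_ne_zero_iff two_ne_zero, hr]
    simp [*]
  refine or_iff_not_imp_left.mpr fun hS => ?_
  have he₁ : ![1, 0] ∈ S :=
    first_basis_mem_of_jordan_invariant (upper_entry_ne_zero hx₁ hy₁ hy₂ hr₀ hr h₁ h₂) hS hS₁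
  have he₂ := hS₃ _ he₁
  refine S.eq_top_iff'.mpr fun v => ?_
  convert S.add_mem (S.smul_mem (v 0) he₁) (S.smul_mem (v 1 / r) he₂) using 1
  ext i; fin_cases i <;> simp [hr₀]
end

section
/- Let x₁ = x₂, suppose y₂z₁ = y₁z₂, and take r = x₂y₁z₂. Then the vector u = (−1/(x₂y₂), 1) satisfies S₁u = x₂u, S₂u = y₁u and S₃u = z₂u; in particular the one-dimensional subspace spanned by u is invariant under S₁, S₂ and S₃, so the representation (S₁, S₂, S₃) is reducible. -/
open Matrix

/-- The line spanned by an eigenvector of a matrix is invariant under the matrix. -/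
theorem mulVec_mem_span_singleton {n R : Type*} [Fintype n] [CommSemiring R]
    {A : Matrix n n R} {u : n → R} {c : R} (h : A.mulVec u = c • u)
    {v : n → R} (hv : v ∈ Submodule.span R {u}) : A.mulVec v ∈ Submodule.span R {u} := by
  obtain ⟨a, rfl⟩ := Submodule.mem_span_singleton.mp hv
  rw [Matrix.mulVec_smul, h]
  exact Submodule.smul_mem _ _ (Submodule.smul_mem _ _ (Submodule.mem_span_singleton_self u))

/-- A line in the plane is a proper subspace. -/
theorem span_singleton_ne_top_of_fin_two {K : Type*} [Field K] (u : Fin 2 → K) :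
    Submodule.span K {u} ≠ ⊤ := by
  intro h
  have hle := finrank_span_le_card (R := K) ({u} : Set (Fin 2 → K))
  rw [h, finrank_top] at hle
  simp at hle

/-- If `x₁ = x₂`, `y₂z₁ = y₁z₂` and `r = x₂y₁z₂`, then `u = (−1/(x₂y₂), 1)`
is a common eigenvector: `S₁u = x₂u`, `S₂u = y₁u`, `S₃u = z₂u`; in particular
the span of `u` is invariant and the representation is reducible. -/
theorem reducible_case1_x1_eq_x2
    (x₁ x₂ y₁ y₂ z₁ z₂ r : ℂ)
    (hx₁ : x₁ ≠ 0) (hx₂ : x₂ ≠ 0) (hy₁ : y₁ ≠ 0) (hy₂ : y₂ ≠ 0)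
    (hz₁ : z₁ ≠ 0) (hz₂ : z₂ ≠ 0)
    (hx : x₁ = x₂) (hyz : y₂ * z₁ = y₁ * z₂) (hrval : r = x₂ * y₁ * z₂) :
    (!![x₁, (y₁ + y₂) / (y₁ * y₂) - x₂ * (z₁ + z₂) / r; 0, x₂]).mulVec
        ![-(1 / (x₂ * y₂)), 1] = x₂ • ![-(1 / (x₂ * y₂)), 1] ∧
    (!![y₁ + y₂, 1 / x₁; -(x₁ * y₁ * y₂), 0]).mulVec
        ![-(1 / (x₂ * y₂)), 1] = y₁ • ![-(1 / (x₂ * y₂)), 1] ∧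
    (!![0, -r / (x₁ * x₂ * y₁ * y₂); r, z₁ + z₂]).mulVec
        ![-(1 / (x₂ * y₂)), 1] = z₂ • ![-(1 / (x₂ * y₂)), 1] ∧
    ∃ S : Submodule ℂ (Fin 2 → ℂ), S ≠ ⊥ ∧ S ≠ ⊤ ∧
      (∀ v ∈ S, (!![x₁, (y₁ + y₂) / (y₁ * y₂) - x₂ * (z₁ + z₂) / r; 0, x₂]).mulVec v ∈ S) ∧
      (∀ v ∈ S, (!![y₁ + y₂, 1 / x₁; -(x₁ * y₁ * y₂), 0]).mulVec v ∈ S) ∧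
      (∀ v ∈ S, (!![0, -r / (x₁ * x₂ * y₁ * y₂); r, z₁ + z₂]).mulVec v ∈ S) := by
  subst hx hrval
  have h₁ : (!![x₁, (y₁ + y₂) / (y₁ * y₂) - x₁ * (z₁ + z₂) / (x₁ * y₁ * z₂); 0, x₁]).mulVec
      ![-(1 / (x₁ * y₂)), 1] = x₁ • ![-(1 / (x₁ * y₂)), 1] := by
    ext i
    fin_cases i
    · simp [Matrix.mulVec, dotProduct, Fin.sum_univ_two]
      field_simp
      linear_combination -hyz
    · simp [Matrix.mulVec, dotProduct, Fin.sum_univ_two]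
  have h₂ : (!![y₁ + y₂, 1 / x₁; -(x₁ * y₁ * y₂), 0]).mulVec
      ![-(1 / (x₁ * y₂)), 1] = y₁ • ![-(1 / (x₁ * y₂)), 1] := by
    ext i
    fin_cases i
    · simp [Matrix.mulVec, dotProduct, Fin.sum_univ_two]
      field_simp
      ring
    · simp [Matrix.mulVec, dotProduct, Fin.sum_univ_two]
      field_simp
  have h₃ : (!![0, -(x₁ * y₁ * z₂) / (x₁ * x₁ * y₁ * y₂); x₁ * y₁ * z₂, z₁ + z₂]).mulVec
      ![-(1 / (x₁ * y₂)), 1] = z₂ • ![-(1 / (x₁ * y₂)), 1] := by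
    ext i
    fin_cases i
    · simp [Matrix.mulVec, dotProduct, Fin.sum_univ_two]
      field_simp
    · simp [Matrix.mulVec, dotProduct, Fin.sum_univ_two]
      field_simp
      linear_combination hyz
  refine ⟨h₁, h₂, h₃, Submodule.span ℂ {![-(1 / (x₁ * y₂)), 1]}, ?_,
    span_singleton_ne_top_of_fin_two _, fun _ => mulVec_mem_span_singleton h₁,
    fun _ => mulVec_mem_span_singleton h₂, fun _ => mulVec_mem_span_singleton h₃⟩
  rw [Ne, Submodule.span_singleton_eq_bot]
  exact fun h => one_ne_zero (congrFun h 1)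
end

section
/- Let x₁ = x₂, suppose y₁z₁ = y₂z₂, and take r = x₂y₂z₂. Then the vector u = (−1/(x₂y₂), 1) satisfies S₁u = x₂u, S₂u = y₁u and S₃u = z₁u (here z₁ = y₂z₂/y₁); in particular the one-dimensional subspace spanned by u is invariant under S₁, S₂ and S₃, so the representation (S₁, S₂, S₃) is reducible. -/
open Matrix

/-- The line spanned by an eigenvector of a matrix is invariant under that matrix. -/
theorem mulVec_mem_span_singleton_of_mulVec_eq_smul {R n : Type*} [CommSemiring R] [Fintype n]
    {A : Matrix n n R} {u : n → R} {c : R} (h : A.mulVec u = c • u) :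
    ∀ v ∈ Submodule.span R {u}, A.mulVec v ∈ Submodule.span R {u} := by
  intro v hv
  obtain ⟨a, rfl⟩ := Submodule.mem_span_singleton.1 hv
  rw [Matrix.mulVec_smul, h]
  exact Submodule.smul_mem _ _ (Submodule.smul_mem _ _ (Submodule.mem_span_singleton_self u))

/-- If `x₁ = x₂`, `y₁z₁ = y₂z₂` and `r = x₂y₂z₂`, then `u = (−1/(x₂y₂), 1)`
is a common eigenvector: `S₁u = x₂u`, `S₂u = y₁u`, `S₃u = z₁u`; in particular
the span of `u` is invariant and the representation is reducible. -/
theorem reducible_case2_x1_eq_x2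
    (x₁ x₂ y₁ y₂ z₁ z₂ r : ℂ)
    (hx₁ : x₁ ≠ 0) (hx₂ : x₂ ≠ 0) (hy₁ : y₁ ≠ 0) (hy₂ : y₂ ≠ 0)
    (hz₁ : z₁ ≠ 0) (hz₂ : z₂ ≠ 0)
    (hx : x₁ = x₂) (hyz : y₁ * z₁ = y₂ * z₂) (hrval : r = x₂ * y₂ * z₂) :
    (!![x₁, (y₁ + y₂) / (y₁ * y₂) - x₂ * (z₁ + z₂) / r; 0, x₂]).mulVec
        ![-(1 / (x₂ * y₂)), 1] = x₂ • ![-(1 / (x₂ * y₂)), 1] ∧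
    (!![y₁ + y₂, 1 / x₁; -(x₁ * y₁ * y₂), 0]).mulVec
        ![-(1 / (x₂ * y₂)), 1] = y₁ • ![-(1 / (x₂ * y₂)), 1] ∧
    (!![0, -r / (x₁ * x₂ * y₁ * y₂); r, z₁ + z₂]).mulVec
        ![-(1 / (x₂ * y₂)), 1] = z₁ • ![-(1 / (x₂ * y₂)), 1] ∧
    ∃ S : Submodule ℂ (Fin 2 → ℂ), S ≠ ⊥ ∧ S ≠ ⊤ ∧
      (∀ v ∈ S, (!![x₁, (y₁ + y₂) / (y₁ * y₂) - x₂ * (z₁ + z₂) / r; 0, x₂]).mulVec v ∈ S) ∧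
      (∀ v ∈ S, (!![y₁ + y₂, 1 / x₁; -(x₁ * y₁ * y₂), 0]).mulVec v ∈ S) ∧
      (∀ v ∈ S, (!![0, -r / (x₁ * x₂ * y₁ * y₂); r, z₁ + z₂]).mulVec v ∈ S) := by
  subst hx hrval
  have hz : z₁ = y₂ * z₂ / y₁ := by
    rw [eq_div_iff hy₁, mul_comm, hyz]
  have eigen₁ : (!![x₁, (y₁ + y₂) / (y₁ * y₂) - x₁ * (z₁ + z₂) / (x₁ * y₂ * z₂); 0, x₁]).mulVec
      ![-(1 / (x₁ * y₂)), 1] = x₁ • ![-(1 / (x₁ * y₂)), 1] := by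
    ext i
    fin_cases i
    · simp [Matrix.mulVec, dotProduct, Fin.sum_univ_two, hz]
      field_simp
      ring
    · simp [Matrix.mulVec, dotProduct, Fin.sum_univ_two]
  have eigen₂ : (!![y₁ + y₂, 1 / x₁; -(x₁ * y₁ * y₂), 0]).mulVec
      ![-(1 / (x₁ * y₂)), 1] = y₁ • ![-(1 / (x₁ * y₂)), 1] := by
    ext i
    fin_cases i <;> simp [Matrix.mulVec, dotProduct, Fin.sum_univ_two] <;> field_simp
    ring
  have eigen₃ : (!![0, -(x₁ * y₂ * z₂) / (x₁ * x₁ * y₁ * y₂); x₁ * y₂ * z₂, z₁ + z₂]).mulVec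
      ![-(1 / (x₁ * y₂)), 1] = z₁ • ![-(1 / (x₁ * y₂)), 1] := by
    ext i
    fin_cases i <;> simp [Matrix.mulVec, dotProduct, Fin.sum_univ_two, hz] <;> field_simp
    ring
  refine ⟨eigen₁, eigen₂, eigen₃, Submodule.span ℂ {![-(1 / (x₁ * y₂)), 1]}, ?_,
    span_singleton_ne_top_of_fin_two _, mulVec_mem_span_singleton_of_mulVec_eq_smul eigen₁,
    mulVec_mem_span_singleton_of_mulVec_eq_smul eigen₂,
    mulVec_mem_span_singleton_of_mulVec_eq_smul eigen₃⟩
  rw [Ne, Submodule.span_singleton_eq_bot]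
  intro h
  simpa using congrFun h 1
end

section
/- Let x₁ = x₂, and assume the square root r is chosen compatibly with the degenerate cases: if y₂z₁ = y₁z₂ then r = x₂y₁z₂, and if y₁z₁ = y₂z₂ then r = x₂y₂z₂. Then the representation (S₁, S₂, S₃) is irreducible if and only if y₂z₁ ≠ y₁z₂ and y₁z₁ ≠ y₂z₂. -/
open Matrix

/-- A subspace of `K²` is everything once it contains a nonzero multiple of `e₀` and a vector
with nonzero second coordinate. -/
theorem Submodule.eq_top_of_fin_two {K : Type*} [Field K] {S : Submodule K (Fin 2 → K)}
    {a b c : K} (ha : a ≠ 0) (hc : c ≠ 0) (h₀ : ![a, 0] ∈ S) (h₁ : ![b, c] ∈ S) : S = ⊤ := by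
  refine eq_top_iff.2 fun w _ => ?_
  have h : w = ((w 0 - w 1 / c * b) / a) • ![a, 0] + (w 1 / c) • ![b, c] := by
    ext i
    fin_cases i <;> simp <;> field_simp
    ring
  rw [h]
  exact S.add_mem (S.smul_mem _ h₀) (S.smul_mem _ h₁)

/-- A subspace of `K²` invariant under a nontrivial Jordan block and under a matrix not fixing
the line of `e₀` is trivial. -/
theorem Submodule.eq_bot_or_eq_top_of_jordanBlock {K : Type*} [Field K]
    {S : Submodule K (Fin 2 → K)} {x b p q c d : K} (hb : b ≠ 0) (hc : c ≠ 0)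
    (hJ : ∀ v ∈ S, (!![x, b; 0, x]).mulVec v ∈ S)
    (hA : ∀ v ∈ S, (!![p, q; c, d]).mulVec v ∈ S) : S = ⊥ ∨ S = ⊤ := by
  refine or_iff_not_imp_left.2 fun hS => ?_
  obtain ⟨v, hv, hv0⟩ := S.ne_bot_iff.1 hS
  obtain ⟨a, ha, haS⟩ : ∃ a : K, a ≠ 0 ∧ ![a, 0] ∈ S := by
    by_cases h1 : v 1 = 0
    · refine ⟨v 0, fun h0 => hv0 ?_, ?_⟩
      · ext i
        fin_cases i <;> assumption
      · convert hv using 1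
        ext i
        fin_cases i <;> simp [h1]
    · refine ⟨b * v 1, mul_ne_zero hb h1, ?_⟩
      convert S.sub_mem (hJ v hv) (S.smul_mem x hv) using 1
      ext i
      fin_cases i <;> simp [dotProduct, Fin.sum_univ_two]
  have h₁ : ![p * a, c * a] ∈ S := by
    convert hA _ haS using 1
    ext i
    fin_cases i <;> simp [Matrix.mulVec, dotProduct, Fin.sum_univ_two]
  exact Submodule.eq_top_of_fin_two ha (mul_ne_zero hc ha) haS h₁

theorem Submodule.span_pair_ne_bot_and_ne_top {K : Type*} [Field K] (t : K) :
    ¬ (Submodule.span K {![1, t]} = ⊥ ∨ Submodule.span K {![1, t]} = ⊤) := by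
  rintro (h | h)
  · have := congrFun (Submodule.span_singleton_eq_bot.1 h) 0
    simp at this
  · obtain ⟨a, ha⟩ := Submodule.mem_span_singleton.1
      (h ▸ Submodule.mem_top : ![0, 1] ∈ Submodule.span K {![1, t]})
    have h0 := congrFun ha 0
    have h1 := congrFun ha 1
    simp at h0 h1
    simp [h0] at h1

theorem Matrix.mulVec_mem_span_of_eigenvector {K : Type*} [Field K] {p q c d t l : K}
    (h₀ : p + q * t = l) (h₁ : c + d * t = l * t) :
    ∀ v ∈ Submodule.span K {![1, t]},
      (!![p, q; c, d]).mulVec v ∈ Submodule.span K {![1, t]} := by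
  intro v hv
  obtain ⟨a, rfl⟩ := Submodule.mem_span_singleton.1 hv
  refine Submodule.mem_span_singleton.2 ⟨a * l, ?_⟩
  ext i
  fin_cases i <;> simp [Matrix.mulVec, dotProduct, Fin.sum_univ_two]
  · linear_combination -a * h₀
  · linear_combination -a * h₁

/-- Theorem 2 of the paper. Let `x₁ = x₂`, with the square root `r` chosen
compatibly in the degenerate cases. Then `(S₁, S₂, S₃)` is irreducible iff
`y₂z₁ ≠ y₁z₂` and `y₁z₁ ≠ y₂z₂`. -/
theorem irreducible_iff_x1_eq_x2
    (x₁ x₂ y₁ y₂ z₁ z₂ r : ℂ)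
    (hx₁ : x₁ ≠ 0) (hx₂ : x₂ ≠ 0) (hy₁ : y₁ ≠ 0) (hy₂ : y₂ ≠ 0)
    (hz₁ : z₁ ≠ 0) (hz₂ : z₂ ≠ 0)
    (hr : r ^ 2 = x₁ * x₂ * y₁ * y₂ * z₁ * z₂)
    (hx : x₁ = x₂)
    (hc₁ : y₂ * z₁ = y₁ * z₂ → r = x₂ * y₁ * z₂)
    (hc₂ : y₁ * z₁ = y₂ * z₂ → r = x₂ * y₂ * z₂) :
    (∀ S : Submodule ℂ (Fin 2 → ℂ),
      (∀ v ∈ S, (!![x₁, (y₁ + y₂) / (y₁ * y₂) - x₂ * (z₁ + z₂) / r; 0, x₂]).mulVec v ∈ S) →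
      (∀ v ∈ S, (!![y₁ + y₂, 1 / x₁; -(x₁ * y₁ * y₂), 0]).mulVec v ∈ S) →
      (∀ v ∈ S, (!![0, -r / (x₁ * x₂ * y₁ * y₂); r, z₁ + z₂]).mulVec v ∈ S) →
      S = ⊥ ∨ S = ⊤) ↔
    (y₂ * z₁ ≠ y₁ * z₂ ∧ y₁ * z₁ ≠ y₂ * z₂) := by
  subst hx
  have hr0 : r ≠ 0 := by
    rintro rfl
    simp_all
  constructor
  · intro H
    refine ⟨fun h => ?_, fun h => ?_⟩
    · have hr' := hc₁ h
      refine Submodule.span_pair_ne_bot_and_ne_top (-(x₁ * y₁)) (H _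
        (Matrix.mulVec_mem_span_of_eigenvector (l := x₁) ?_ ?_)
        (Matrix.mulVec_mem_span_of_eigenvector (l := y₂) ?_ ?_)
        (Matrix.mulVec_mem_span_of_eigenvector (l := z₁) ?_ ?_))
      all_goals subst hr'
      all_goals try field_simp
      all_goals grind
    · have hr' := hc₂ h
      refine Submodule.span_pair_ne_bot_and_ne_top (-(x₁ * y₂)) (H _
        (Matrix.mulVec_mem_span_of_eigenvector (l := x₁) ?_ ?_)
        (Matrix.mulVec_mem_span_of_eigenvector (l := y₁) ?_ ?_)
        (Matrix.mulVec_mem_span_of_eigenvector (l := z₁) ?_ ?_))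
      all_goals subst hr'
      all_goals try field_simp
      all_goals grind
  · rintro ⟨h₁, h₂⟩ S hS₁ hS₂ -
    refine Submodule.eq_bot_or_eq_top_of_jordanBlock (fun hb => ?_) ?_ hS₁ hS₂
    · have hb' : r * (y₁ + y₂) = x₁ * y₁ * y₂ * (z₁ + z₂) := by
        field_simp at hb
        linear_combination hb
      have key : (x₁ ^ 2 * y₁ * y₂) * ((y₁ * z₁ - y₂ * z₂) * (y₂ * z₁ - y₁ * z₂)) = 0 := by
        linear_combination (y₁ + y₂) ^ 2 * hr
          - (r * (y₁ + y₂) + x₁ * y₁ * y₂ * (z₁ + z₂)) * hb'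
      have hxy : x₁ ^ 2 * y₁ * y₂ ≠ 0 := by simp [*]
      exact mul_ne_zero hxy (mul_ne_zero (sub_ne_zero.2 h₂) (sub_ne_zero.2 h₁)) key
    · simp [*]
end

section
/- With r² = x₁x₂y₁y₂z₁z₂, if α = x₂y₁y₂z₁ + x₁y₁y₂z₂ − (y₁+y₂)r equals 0, then x₁y₁z₂ = x₂y₂z₁ or x₁y₂z₂ = x₂y₁z₁. -/
/-- With `r² = x₁x₂y₁y₂z₁z₂`, if `α = x₂y₁y₂z₁ + x₁y₁y₂z₂ − (y₁+y₂)r = 0`,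
then `x₁y₁z₂ = x₂y₂z₁` or `x₁y₂z₂ = x₂y₁z₁`. -/
theorem alpha_zero_implies
    (x₁ x₂ y₁ y₂ z₁ z₂ r : ℂ)
    (hx₁ : x₁ ≠ 0) (hx₂ : x₂ ≠ 0) (hy₁ : y₁ ≠ 0) (hy₂ : y₂ ≠ 0)
    (hz₁ : z₁ ≠ 0) (hz₂ : z₂ ≠ 0)
    (hr : r ^ 2 = x₁ * x₂ * y₁ * y₂ * z₁ * z₂)
    (hα : x₂ * y₁ * y₂ * z₁ + x₁ * y₁ * y₂ * z₂ - (y₁ + y₂) * r = 0) :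
    x₁ * y₁ * z₂ = x₂ * y₂ * z₁ ∨ x₁ * y₂ * z₂ = x₂ * y₁ * z₁ := by
  have hprod : y₁ * y₂ *
      ((x₁ * y₁ * z₂ - x₂ * y₂ * z₁) * (x₁ * y₂ * z₂ - x₂ * y₁ * z₁)) = 0 := by
    linear_combination
      (x₂ * y₁ * y₂ * z₁ + x₁ * y₁ * y₂ * z₂ + (y₁ + y₂) * r) * hα + (y₁ + y₂) ^ 2 * hr
  have hfactor := (mul_eq_zero.mp hprod).resolve_left (mul_ne_zero hy₁ hy₂)
  exact (mul_eq_zero.mp hfactor).imp sub_eq_zero.mp sub_eq_zero.mp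
end

section
/- With r² = x₁x₂y₁y₂z₁z₂, if x₁y₂z₂ ≠ x₂y₁z₁, x₁y₁z₂ ≠ x₂y₂z₁, x₁y₂z₁ ≠ x₂y₁z₂ and x₁y₁z₁ ≠ x₂y₂z₂, then w ≠ 0. -/
/-- With `r² = x₁x₂y₁y₂z₁z₂`, if `x₁y₂z₂ ≠ x₂y₁z₁`, `x₁y₁z₂ ≠ x₂y₂z₁`,
`x₁y₂z₁ ≠ x₂y₁z₂` and `x₁y₁z₁ ≠ x₂y₂z₂`, then `w ≠ 0`. -/
theorem w_ne_zero
    (x₁ x₂ y₁ y₂ z₁ z₂ r : ℂ)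
    (hx₁ : x₁ ≠ 0) (hx₂ : x₂ ≠ 0) (hy₁ : y₁ ≠ 0) (hy₂ : y₂ ≠ 0)
    (hz₁ : z₁ ≠ 0) (hz₂ : z₂ ≠ 0)
    (hr : r ^ 2 = x₁ * x₂ * y₁ * y₂ * z₁ * z₂)
    (h₁ : x₁ * y₂ * z₂ ≠ x₂ * y₁ * z₁) (h₂ : x₁ * y₁ * z₂ ≠ x₂ * y₂ * z₁)
    (h₃ : x₁ * y₂ * z₁ ≠ x₂ * y₁ * z₂) (h₄ : x₁ * y₁ * z₁ ≠ x₂ * y₂ * z₂) :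
    (x₁ - x₂) ^ 2 * y₁ ^ 2 * y₂ ^ 2 * z₁ * z₂ +
      ((y₁ + y₂) * r - x₁ * y₁ * y₂ * (z₁ + z₂)) *
        ((y₁ + y₂) * r - x₂ * y₁ * y₂ * (z₁ + z₂)) ≠ 0 := by
  intro h
  -- Multiplying `w` by its conjugate under `r ↦ -r` gives a product of the excluded differences.
  have norm_eq_zero : (y₁ * y₂) ^ 2 * ((x₁ * y₂ * z₂ - x₂ * y₁ * z₁) *
      (x₁ * y₁ * z₂ - x₂ * y₂ * z₁) * (x₁ * y₂ * z₁ - x₂ * y₁ * z₂) *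
      (x₁ * y₁ * z₁ - x₂ * y₂ * z₂)) = 0 := by
    linear_combination
      ((x₁ - x₂) ^ 2 * y₁ ^ 2 * y₂ ^ 2 * z₁ * z₂ +
          (y₁ + y₂) ^ 2 * (x₁ * x₂ * y₁ * y₂ * z₁ * z₂) +
          x₁ * x₂ * y₁ ^ 2 * y₂ ^ 2 * (z₁ + z₂) ^ 2 +
          (x₁ + x₂) * y₁ * y₂ * (y₁ + y₂) * (z₁ + z₂) * r) * h +
      (((x₁ + x₂) * y₁ * y₂ * (y₁ + y₂) * (z₁ + z₂)) ^ 2 - (y₁ + y₂) ^ 2 *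
        ((x₁ - x₂) ^ 2 * y₁ ^ 2 * y₂ ^ 2 * z₁ * z₂ +
          (y₁ + y₂) ^ 2 * (x₁ * x₂ * y₁ * y₂ * z₁ * z₂) +
          x₁ * x₂ * y₁ ^ 2 * y₂ ^ 2 * (z₁ + z₂) ^ 2 +
          (x₁ + x₂) * y₁ * y₂ * (y₁ + y₂) * (z₁ + z₂) * r)) * hr
  simp [hy₁, hy₂, sub_eq_zero, h₁, h₂, h₃, h₄] at norm_eq_zero
end

section
/- Let x₁ ≠ x₂. If x₁y₂z₂ ≠ x₂y₁z₁, x₁y₁z₂ ≠ x₂y₂z₁, x₁y₂z₁ ≠ x₂y₁z₂ and x₁y₁z₁ ≠ x₂y₂z₂, then the representation (S₁, S₂, S₃) is irreducible: every ℂ-linear subspace of ℂ² mapped into itself by each of S₁, S₂, S₃ is {0} or ℂ². -/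
open Matrix

/-- A subspace of `K²` containing two vectors with nonzero determinant is everything. -/
theorem Submodule.eq_top_of_mem_of_det_ne_zero {K : Type*} [Field K]
    {S : Submodule K (Fin 2 → K)} {v w : Fin 2 → K} (hv : v ∈ S) (hw : w ∈ S)
    (h : v 0 * w 1 - v 1 * w 0 ≠ 0) : S = ⊤ := by
  refine (Submodule.eq_top_iff').2 fun u => ?_
  have hu : u = ((u 0 * w 1 - u 1 * w 0) / (v 0 * w 1 - v 1 * w 0)) • v +
      ((v 0 * u 1 - v 1 * u 0) / (v 0 * w 1 - v 1 * w 0)) • w := by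
    ext i
    simp only [Pi.add_apply, Pi.smul_apply, smul_eq_mul, div_mul_eq_mul_div, ← add_div]
    rw [eq_div_iff h]
    fin_cases i <;> simp only [Fin.zero_eta, Fin.mk_one] <;> ring
  rw [hu]
  exact S.add_mem (S.smul_mem _ hv) (S.smul_mem _ hw)

/-- If `r = x₁yz` and `r² = x₁x₂yy'zz'`, then `x₁yz = x₂y'z'`. -/
theorem mul_mul_eq_of_eq_of_sq_eq {K : Type*} [Field K] {x₁ x₂ y y' z z' r : K}
    (hx₁ : x₁ ≠ 0) (hy : y ≠ 0) (hz : z ≠ 0) (h : r = x₁ * y * z)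
    (hr : r ^ 2 = x₁ * x₂ * y * y' * z * z') : x₁ * y * z = x₂ * y' * z' := by
  subst h
  refine mul_left_cancel₀ (mul_ne_zero (mul_ne_zero hx₁ hy) hz) ?_
  linear_combination hr

/-- If `x₁ ≠ x₂`, `x₁y₂z₂ ≠ x₂y₁z₁`, `x₁y₁z₂ ≠ x₂y₂z₁`, `x₁y₂z₁ ≠ x₂y₁z₂`
and `x₁y₁z₁ ≠ x₂y₂z₂`, then the representation `(S₁, S₂, S₃)` is irreducible:
every subspace of `ℂ²` invariant under all three matrices is `⊥` or `⊤`. -/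
theorem irreducible_of_x1_ne_x2
    (x₁ x₂ y₁ y₂ z₁ z₂ r : ℂ)
    (hx₁ : x₁ ≠ 0) (hx₂ : x₂ ≠ 0) (hy₁ : y₁ ≠ 0) (hy₂ : y₂ ≠ 0)
    (hz₁ : z₁ ≠ 0) (hz₂ : z₂ ≠ 0)
    (hr : r ^ 2 = x₁ * x₂ * y₁ * y₂ * z₁ * z₂)
    (hx : x₁ ≠ x₂)
    (h₁ : x₁ * y₂ * z₂ ≠ x₂ * y₁ * z₁) (h₂ : x₁ * y₁ * z₂ ≠ x₂ * y₂ * z₁)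
    (h₃ : x₁ * y₂ * z₁ ≠ x₂ * y₁ * z₂) (h₄ : x₁ * y₁ * z₁ ≠ x₂ * y₂ * z₂) :
    ∀ S : Submodule ℂ (Fin 2 → ℂ),
      (∀ v ∈ S, (!![x₁, (y₁ + y₂) / (y₁ * y₂) - x₂ * (z₁ + z₂) / r; 0, x₂]).mulVec v ∈ S) →
      (∀ v ∈ S, (!![y₁ + y₂, 1 / x₁; -(x₁ * y₁ * y₂), 0]).mulVec v ∈ S) →
      (∀ v ∈ S, (!![0, -r / (x₁ * x₂ * y₁ * y₂); r, z₁ + z₂]).mulVec v ∈ S) →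
      S = ⊥ ∨ S = ⊤ := by
  intro S _ hS₂ hS₃
  have hr0 : r ≠ 0 := by
    rintro rfl
    simp_all
  by_contra! hS
  obtain ⟨v, hv, hv0⟩ := S.ne_bot_iff.1 hS.1
  have hdet {w : Fin 2 → ℂ} (hw : w ∈ S) : v 0 * w 1 - v 1 * w 0 = 0 := by
    by_contra h
    exact hS.2 (Submodule.eq_top_of_mem_of_det_ne_zero hv hw h)
  have e₂ := hdet (hS₂ v hv)
  have e₃ := hdet (hS₃ v hv)
  simp only [Matrix.mulVec, dotProduct, Fin.sum_univ_two, Matrix.of_apply, Matrix.cons_val_zero,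
    Matrix.cons_val_one, Matrix.cons_val_fin_one] at e₂ e₃
  have f₂ : (x₁ * y₁ * v 0 + v 1) * (x₁ * y₂ * v 0 + v 1) = 0 := by
    field_simp at e₂
    linear_combination -e₂
  have hq : r / (x₁ * x₂ * y₁ * y₂) = z₁ * z₂ / r := by
    rw [div_eq_div_iff (by simp [*]) hr0]
    linear_combination hr
  have f₃ : (r * v 0 + z₁ * v 1) * (r * v 0 + z₂ * v 1) = 0 := by
    rw [neg_div, hq] at e₃
    field_simp at e₃
    linear_combination e₃
  have hv00 : v 0 ≠ 0 := by
    intro h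
    refine hv0 (funext fun i => ?_)
    fin_cases i
    · exact h
    · simpa [h] using f₂
  have hreq {y z : ℂ} (hy : x₁ * y * v 0 + v 1 = 0) (hz : r * v 0 + z * v 1 = 0) :
      r = x₁ * y * z := by
    refine mul_right_cancel₀ hv00 ?_
    linear_combination hz - z * hy
  rcases mul_eq_zero.1 f₂ with hy | hy <;> rcases mul_eq_zero.1 f₃ with hz | hz
  · exact h₄ (mul_mul_eq_of_eq_of_sq_eq hx₁ hy₁ hz₁ (hreq hy hz) hr)
  · exact h₂ (mul_mul_eq_of_eq_of_sq_eq hx₁ hy₁ hz₂ (hreq hy hz) (by linear_combination hr))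
  · exact h₃ (mul_mul_eq_of_eq_of_sq_eq hx₁ hy₂ hz₁ (hreq hy hz) (by linear_combination hr))
  · exact h₁ (mul_mul_eq_of_eq_of_sq_eq hx₁ hy₂ hz₂ (hreq hy hz) (by linear_combination hr))
end

section
/- Let x₁ ≠ x₂, and suppose one of the following holds: (x₁y₂z₂ = x₂y₁z₁ and r = x₂y₁z₁), or (x₁y₁z₂ = x₂y₂z₁ and r = x₂y₂z₁), or (x₁y₂z₁ = x₂y₁z₂ and r = x₁y₂z₁), or (x₁y₁z₁ = x₂y₂z₂ and r = x₁y₁z₁). Then the representation (S₁, S₂, S₃) is reducible: there exists a ℂ-linear subspace S of ℂ² with S ≠ {0} and S ≠ ℂ² that is mapped into itself by each of S₁, S₂ and S₃. -/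
open Matrix

/-- The line spanned by an eigenvector is invariant. -/
theorem mulVec_mem_span_singleton_of_eigenvector {K n : Type*} [Field K] [Fintype n]
    {A : Matrix n n K} {u : n → K} {c : K} (h : A.mulVec u = c • u) :
    ∀ v ∈ Submodule.span K {u}, A.mulVec v ∈ Submodule.span K {u} := by
  intro v hv
  obtain ⟨a, rfl⟩ := Submodule.mem_span_singleton.1 hv
  rw [Matrix.mulVec_smul, h]
  exact Submodule.smul_mem _ _ (Submodule.smul_mem _ _ (Submodule.mem_span_singleton_self u))

/-- If `r = x₂ y₁ z₁ = x₁ y₂ z₂`, then `(1, -x₁ y₂)` is a common eigenvector of the three matrices,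
with eigenvalues `x₂`, `y₁` and `z₁`. -/
theorem exists_invariant_line {x₁ x₂ y₁ y₂ z₁ z₂ r : ℂ}
    (hx₁ : x₁ ≠ 0) (hx₂ : x₂ ≠ 0) (hy₁ : y₁ ≠ 0) (hy₂ : y₂ ≠ 0) (hz₁ : z₁ ≠ 0)
    (hr : r = x₂ * y₁ * z₁) (h : x₁ * y₂ * z₂ = x₂ * y₁ * z₁) :
    ∃ S : Submodule ℂ (Fin 2 → ℂ), S ≠ ⊥ ∧ S ≠ ⊤ ∧
      (∀ v ∈ S, (!![x₁, (y₁ + y₂) / (y₁ * y₂) - x₂ * (z₁ + z₂) / r; 0, x₂]).mulVec v ∈ S) ∧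
      (∀ v ∈ S, (!![y₁ + y₂, 1 / x₁; -(x₁ * y₁ * y₂), 0]).mulVec v ∈ S) ∧
      (∀ v ∈ S, (!![0, -r / (x₁ * x₂ * y₁ * y₂); r, z₁ + z₂]).mulVec v ∈ S) := by
  refine ⟨Submodule.span ℂ {![1, -(x₁ * y₂)]}, ?_, ?_,
    mulVec_mem_span_singleton_of_eigenvector (c := x₂) ?_,
    mulVec_mem_span_singleton_of_eigenvector (c := y₁) ?_,
    mulVec_mem_span_singleton_of_eigenvector (c := z₁) ?_⟩
  · rw [Ne, Submodule.span_singleton_eq_bot]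
    intro h0
    simpa using congrFun h0 0
  · intro htop
    have hmem : (![0, 1] : Fin 2 → ℂ) ∈ Submodule.span ℂ {![1, -(x₁ * y₂)]} := by
      rw [htop]
      trivial
    obtain ⟨a, ha⟩ := Submodule.mem_span_singleton.1 hmem
    have ha₀ : a = 0 := by simpa using congrFun ha 0
    simpa [ha₀] using congrFun ha 1
  · subst hr
    ext i
    fin_cases i
    · simp [Matrix.mulVec, dotProduct, Fin.sum_univ_two]
      field_simp
      linear_combination h
    · simp [Matrix.mulVec, dotProduct, Fin.sum_univ_two]
  · ext i
    fin_cases i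
    · simp [Matrix.mulVec, dotProduct, Fin.sum_univ_two]
      field_simp
      ring
    · simp [Matrix.mulVec, dotProduct, Fin.sum_univ_two]
      ring
  · subst hr
    ext i
    fin_cases i
    · simp [Matrix.mulVec, dotProduct, Fin.sum_univ_two]
      field_simp
    · simp [Matrix.mulVec, dotProduct, Fin.sum_univ_two]
      linear_combination -h

/-- If `x₁ ≠ x₂` and one of the degenerate conditions holds (with `r` chosen as
the indicated value of the square root), then the representation `(S₁, S₂, S₃)`
is reducible: there is a nontrivial proper invariant subspace of `ℂ²`. -/
theorem reducible_of_degenerate_x1_ne_x2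
    (x₁ x₂ y₁ y₂ z₁ z₂ r : ℂ)
    (hx₁ : x₁ ≠ 0) (hx₂ : x₂ ≠ 0) (hy₁ : y₁ ≠ 0) (hy₂ : y₂ ≠ 0)
    (hz₁ : z₁ ≠ 0) (hz₂ : z₂ ≠ 0)
    (hx : x₁ ≠ x₂)
    (h : (x₁ * y₂ * z₂ = x₂ * y₁ * z₁ ∧ r = x₂ * y₁ * z₁) ∨
         (x₁ * y₁ * z₂ = x₂ * y₂ * z₁ ∧ r = x₂ * y₂ * z₁) ∨
         (x₁ * y₂ * z₁ = x₂ * y₁ * z₂ ∧ r = x₁ * y₂ * z₁) ∨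
         (x₁ * y₁ * z₁ = x₂ * y₂ * z₂ ∧ r = x₁ * y₁ * z₁)) :
    ∃ S : Submodule ℂ (Fin 2 → ℂ), S ≠ ⊥ ∧ S ≠ ⊤ ∧
      (∀ v ∈ S, (!![x₁, (y₁ + y₂) / (y₁ * y₂) - x₂ * (z₁ + z₂) / r; 0, x₂]).mulVec v ∈ S) ∧
      (∀ v ∈ S, (!![y₁ + y₂, 1 / x₁; -(x₁ * y₁ * y₂), 0]).mulVec v ∈ S) ∧
      (∀ v ∈ S, (!![0, -r / (x₁ * x₂ * y₁ * y₂); r, z₁ + z₂]).mulVec v ∈ S) := by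
  rcases h with ⟨h, hr⟩ | ⟨h, hr⟩ | ⟨h, hr⟩ | ⟨h, hr⟩
  · exact exists_invariant_line hx₁ hx₂ hy₁ hy₂ hz₁ hr h
  · rw [add_comm y₁ y₂, mul_comm y₁ y₂, mul_right_comm x₁ y₁ y₂,
      mul_right_comm (x₁ * x₂) y₁ y₂]
    exact exists_invariant_line hx₁ hx₂ hy₂ hy₁ hz₁ hr h
  · rw [add_comm z₁ z₂]
    exact exists_invariant_line hx₁ hx₂ hy₁ hy₂ hz₂ (hr.trans h) h
  · rw [add_comm y₁ y₂, mul_comm y₁ y₂, mul_right_comm x₁ y₁ y₂,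
      mul_right_comm (x₁ * x₂) y₁ y₂, add_comm z₁ z₂]
    exact exists_invariant_line hx₁ hx₂ hy₂ hy₁ hz₂ (hr.trans h) h
end

section
/- Let x₁ ≠ x₂, and assume the square root r is chosen compatibly with the degenerate cases: if x₁y₂z₂ = x₂y₁z₁ then r = x₂y₁z₁; if x₁y₁z₂ = x₂y₂z₁ then r = x₂y₂z₁; if x₁y₂z₁ = x₂y₁z₂ then r = x₁y₂z₁; and if x₁y₁z₁ = x₂y₂z₂ then r = x₁y₁z₁. Then the representation (S₁, S₂, S₃) is irreducible if and only if x₁y₂z₂ ≠ x₂y₁z₁, x₁y₁z₂ ≠ x₂y₂z₁, x₁y₂z₁ ≠ x₂y₁z₂ and x₁y₁z₁ ≠ x₂y₂z₂. -/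
open Matrix

/-- Two vectors of a proper subspace of a plane have vanishing determinant. -/
theorem det_eq_zero_of_ne_top {K : Type*} [Field K] {S : Submodule K (Fin 2 → K)} (hS : S ≠ ⊤)
    {v w : Fin 2 → K} (hv : v ∈ S) (hw : w ∈ S) : v 0 * w 1 - v 1 * w 0 = 0 := by
  by_contra hd
  refine hS (S.eq_top_iff'.mpr fun u => ?_)
  have hu : u = ((u 0 * w 1 - u 1 * w 0) / (v 0 * w 1 - v 1 * w 0)) • v +
      ((v 0 * u 1 - v 1 * u 0) / (v 0 * w 1 - v 1 * w 0)) • w := by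
    refine funext (Fin.forall_fin_two.mpr ⟨?_, ?_⟩) <;>
    · simp only [Pi.add_apply, Pi.smul_apply, smul_eq_mul]
      rw [div_mul_eq_mul_div, div_mul_eq_mul_div, ← add_div, eq_div_iff hd]
      ring
  rw [hu]
  exact S.add_mem (S.smul_mem _ hv) (S.smul_mem _ hw)

theorem mulVec_mem_span_singleton_s14 {K n : Type*} [Field K] [Fintype n] {A : Matrix n n K}
    {w : n → K} {μ : K} (hw : A *ᵥ w = μ • w) :
    ∀ v ∈ Submodule.span K {w}, A *ᵥ v ∈ Submodule.span K {w} := by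
  intro v hv
  obtain ⟨c, rfl⟩ := Submodule.mem_span_singleton.mp hv
  rw [mulVec_smul, hw]
  exact Submodule.smul_mem _ _ (Submodule.smul_mem _ _ (Submodule.mem_span_singleton_self w))

/-- If `r = x₂y₁z₁ = x₁y₂z₂`, then `(1, -x₁y₂)` spans a line invariant under
`S₁`, `S₂` and `S₃`. -/
theorem not_irreducible_of_root_eq {x₁ x₂ y₁ y₂ z₁ z₂ r : ℂ}
    (hx₁ : x₁ ≠ 0) (hx₂ : x₂ ≠ 0) (hy₁ : y₁ ≠ 0) (hy₂ : y₂ ≠ 0) (hz₁ : z₁ ≠ 0)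
    (hr : r = x₂ * y₁ * z₁) (h : x₁ * y₂ * z₂ = x₂ * y₁ * z₁) :
    ¬ ∀ S : Submodule ℂ (Fin 2 → ℂ),
      (∀ v ∈ S, (!![x₁, (y₁ + y₂) / (y₁ * y₂) - x₂ * (z₁ + z₂) / r; 0, x₂]).mulVec v ∈ S) →
      (∀ v ∈ S, (!![y₁ + y₂, 1 / x₁; -(x₁ * y₁ * y₂), 0]).mulVec v ∈ S) →
      (∀ v ∈ S, (!![0, -r / (x₁ * x₂ * y₁ * y₂); r, z₁ + z₂]).mulVec v ∈ S) →
      S = ⊥ ∨ S = ⊤ := by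
  intro hirr
  have hz₂ : z₂ = x₂ * y₁ * z₁ / (x₁ * y₂) := by
    field_simp
    linear_combination h
  subst hr hz₂
  have hS := hirr (Submodule.span ℂ {![1, -(x₁ * y₂)]})
    (mulVec_mem_span_singleton_s14 (μ := x₂) (by
      ext i
      fin_cases i <;> simp [mulVec, dotProduct, Fin.sum_univ_two] <;> field_simp <;> ring))
    (mulVec_mem_span_singleton_s14 (μ := y₁) (by
      ext i
      fin_cases i <;> simp [mulVec, dotProduct, Fin.sum_univ_two] <;> field_simp <;> ring))
    (mulVec_mem_span_singleton_s14 (μ := z₁) (by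
      ext i
      fin_cases i <;> simp [mulVec, dotProduct, Fin.sum_univ_two] <;> field_simp <;> ring))
  rcases hS with hS | hS
  · simpa using congrFun (Submodule.span_singleton_eq_bot.mp hS) 0
  · have hmem : ![0, 1] ∈ Submodule.span ℂ {![1, -(x₁ * y₂)]} := hS ▸ Submodule.mem_top
    obtain ⟨c, hc⟩ := Submodule.mem_span_singleton.mp hmem
    have h0 : c = 0 := by simpa using congrFun hc 0
    simpa [h0] using congrFun hc 1

/-- If `(a, c)` is an eigenvector of `S₂` for `y₁` and also an eigenvector of `S₃`, then
`r = x₂y₁z₁` or `r = x₂y₁z₂`. -/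
theorem root_of_common_eigenvector {K : Type*} [Field K] {x₁ x₂ y₁ y₂ z₁ z₂ r a c : K}
    (hx₁ : x₁ ≠ 0) (hy₂ : y₂ ≠ 0) (ha : a ≠ 0)
    (hr : r ^ 2 = x₁ * x₂ * y₁ * y₂ * z₁ * z₂) (hc : c + x₁ * y₂ * a = 0)
    (h : r * c ^ 2 + x₁ * x₂ * y₁ * y₂ * a * (r * a + (z₁ + z₂) * c) = 0) :
    r = x₂ * y₁ * z₁ ∨ r = x₂ * y₁ * z₂ := by
  obtain rfl : c = -(x₁ * y₂ * a) := by linear_combination hc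
  have h' : r * (x₁ * y₂ + x₂ * y₁) = x₁ * x₂ * y₁ * y₂ * (z₁ + z₂) := by
    refine mul_left_cancel₀ (mul_ne_zero (mul_ne_zero hx₁ hy₂) (pow_ne_zero 2 ha)) ?_
    linear_combination h
  have hprod : x₁ * y₂ * ((r - x₂ * y₁ * z₁) * (r - x₂ * y₁ * z₂)) = 0 := by
    linear_combination r * h' - x₂ * y₁ * hr
  rcases mul_eq_zero.mp ((mul_eq_zero.mp hprod).resolve_left (mul_ne_zero hx₁ hy₂)) with e | e
  · exact Or.inl (sub_eq_zero.mp e)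
  · exact Or.inr (sub_eq_zero.mp e)

/-- Theorem 3 of the paper. Let `x₁ ≠ x₂`, with the square root `r` chosen
compatibly in the degenerate cases. Then `(S₁, S₂, S₃)` is irreducible iff
`x₁y₂z₂ ≠ x₂y₁z₁`, `x₁y₁z₂ ≠ x₂y₂z₁`, `x₁y₂z₁ ≠ x₂y₁z₂` and `x₁y₁z₁ ≠ x₂y₂z₂`. -/
theorem irreducible_iff_x1_ne_x2
    (x₁ x₂ y₁ y₂ z₁ z₂ r : ℂ)
    (hx₁ : x₁ ≠ 0) (hx₂ : x₂ ≠ 0) (hy₁ : y₁ ≠ 0) (hy₂ : y₂ ≠ 0)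
    (hz₁ : z₁ ≠ 0) (hz₂ : z₂ ≠ 0)
    (hr : r ^ 2 = x₁ * x₂ * y₁ * y₂ * z₁ * z₂)
    (hx : x₁ ≠ x₂)
    (hc₁ : x₁ * y₂ * z₂ = x₂ * y₁ * z₁ → r = x₂ * y₁ * z₁)
    (hc₂ : x₁ * y₁ * z₂ = x₂ * y₂ * z₁ → r = x₂ * y₂ * z₁)
    (hc₃ : x₁ * y₂ * z₁ = x₂ * y₁ * z₂ → r = x₁ * y₂ * z₁)
    (hc₄ : x₁ * y₁ * z₁ = x₂ * y₂ * z₂ → r = x₁ * y₁ * z₁) :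
    (∀ S : Submodule ℂ (Fin 2 → ℂ),
      (∀ v ∈ S, (!![x₁, (y₁ + y₂) / (y₁ * y₂) - x₂ * (z₁ + z₂) / r; 0, x₂]).mulVec v ∈ S) →
      (∀ v ∈ S, (!![y₁ + y₂, 1 / x₁; -(x₁ * y₁ * y₂), 0]).mulVec v ∈ S) →
      (∀ v ∈ S, (!![0, -r / (x₁ * x₂ * y₁ * y₂); r, z₁ + z₂]).mulVec v ∈ S) →
      S = ⊥ ∨ S = ⊤) ↔
    (x₁ * y₂ * z₂ ≠ x₂ * y₁ * z₁ ∧ x₁ * y₁ * z₂ ≠ x₂ * y₂ * z₁ ∧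
     x₁ * y₂ * z₁ ≠ x₂ * y₁ * z₂ ∧ x₁ * y₁ * z₁ ≠ x₂ * y₂ * z₂) := by
  constructor
  · intro h
    refine ⟨fun e => ?_, fun e => ?_, fun e => ?_, fun e => ?_⟩
    · exact not_irreducible_of_root_eq hx₁ hx₂ hy₁ hy₂ hz₁ (hc₁ e) e h
    · have key := not_irreducible_of_root_eq hx₁ hx₂ hy₂ hy₁ hz₁ (hc₂ e) e
      rw [add_comm y₂ y₁, mul_comm y₂ y₁, mul_right_comm x₁ y₂ y₁,
        mul_right_comm (x₁ * x₂) y₂ y₁] at key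
      exact key h
    · have key := not_irreducible_of_root_eq hx₁ hx₂ hy₁ hy₂ hz₂ ((hc₃ e).trans e) e
      rw [add_comm z₂ z₁] at key
      exact key h
    · have key := not_irreducible_of_root_eq hx₁ hx₂ hy₂ hy₁ hz₂ ((hc₄ e).trans e) e
      rw [add_comm y₂ y₁, add_comm z₂ z₁, mul_comm y₂ y₁, mul_right_comm x₁ y₂ y₁,
        mul_right_comm (x₁ * x₂) y₂ y₁] at key
      exact key h
  · rintro ⟨h₁, h₂, h₃, h₄⟩ S - hS₂ hS₃
    by_contra! hS
    obtain ⟨v, hv, hv0⟩ := S.ne_bot_iff.mp hS.1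
    have hr0 : r ≠ 0 := by
      rintro rfl
      simp_all
    have d₂ := det_eq_zero_of_ne_top hS.2 hv (hS₂ v hv)
    have d₃ := det_eq_zero_of_ne_top hS.2 hv (hS₃ v hv)
    simp only [mulVec, dotProduct, Fin.sum_univ_two, of_apply, cons_val', cons_val_zero,
      cons_val_one, cons_val_fin_one] at d₂ d₃
    field_simp at d₂ d₃
    have ha : v 0 ≠ 0 := by
      intro h0
      have h1 : v 1 = 0 := by simpa [h0] using d₂
      exact hv0 (by ext i; fin_cases i <;> simp [h0, h1])
    have hf : (v 1 + x₁ * y₂ * v 0) * (v 1 + x₁ * y₁ * v 0) = 0 := by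
      linear_combination -d₂
    have d₃' : r * v 1 ^ 2 + x₁ * x₂ * y₁ * y₂ * v 0 * (r * v 0 + (z₁ + z₂) * v 1) = 0 := by
      linear_combination d₃
    rcases mul_eq_zero.mp hf with hf | hf
    · rcases root_of_common_eigenvector hx₁ hy₂ ha hr hf d₃' with e | e
      · exact h₁ (mul_left_cancel₀ hr0 (by linear_combination (x₁ * y₂ * z₂ + r) * e - hr))
      · exact h₃ (mul_left_cancel₀ hr0 (by linear_combination (x₁ * y₂ * z₁ + r) * e - hr))
    · rcases root_of_common_eigenvector (x₂ := x₂) (y₁ := y₂) (z₁ := z₁) (z₂ := z₂) (r := r) hx₁ hy₁ ha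
        (by linear_combination hr) hf (by linear_combination d₃') with e | e
      · exact h₂ (mul_left_cancel₀ hr0 (by linear_combination (x₁ * y₁ * z₂ + r) * e - hr))
      · exact h₄ (mul_left_cancel₀ hr0 (by linear_combination (x₁ * y₁ * z₁ + r) * e - hr))
end
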